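/- arXiv:1701.03281 — 2 statements merged into one kernel-verified Lean document; each statement's English description precedes it below -/
import Mathlib

section
/- The multi-channel convolution ⊛ of filters is associative: for all finitely supported filters F¹, F², F³ : ℤ × ℤ × (ℤ × ℤ) → ℝ, one has F³ ⊛ (F² ⊛ F¹) = (F³ ⊛ F²) ⊛ F¹. -/
/-- Multi-channel convolution of filters:
`(F² ⊛ F¹)(c_j, c_i, x) = Σ_{c_l} Σ_y F²(c_j, c_l, y) · F¹(c_l, c_i, x − y)`. -/
noncomputable def fconv (F2 F1 : ℤ × ℤ × (ℤ × ℤ) → ℝ) : ℤ × ℤ × (ℤ × ℤ) → ℝ :=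
  fun p => ∑ᶠ (cl : ℤ) (y : ℤ × ℤ), F2 (p.1, cl, y) * F1 (cl, p.2.1, p.2.2 - y)

open scoped Pointwise

/-- A finitely supported filter vanishes unless its input channel and its position lie in
suitable finite sets. -/
theorem exists_finset_of_finite_support {F : ℤ × ℤ × (ℤ × ℤ) → ℝ}
    (h : (Function.support F).Finite) :
    ∃ (S : Finset ℤ) (T : Finset (ℤ × ℤ)), ∀ a l y, F (a, l, y) ≠ 0 → l ∈ S ∧ y ∈ T := by
  refine ⟨h.toFinset.image fun p => p.2.1, h.toFinset.image fun p => p.2.2, fun a l y hF => ?_⟩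
  have hmem : (a, l, y) ∈ h.toFinset := by simpa using hF
  exact ⟨Finset.mem_image_of_mem (fun p : ℤ × ℤ × (ℤ × ℤ) => p.2.1) hmem,
    Finset.mem_image_of_mem (fun p : ℤ × ℤ × (ℤ × ℤ) => p.2.2) hmem⟩

theorem fconv_eq_sum {G : ℤ × ℤ × (ℤ × ℤ) → ℝ} {S : Finset ℤ} {T : Finset (ℤ × ℤ)}
    (hG : ∀ a l y, G (a, l, y) ≠ 0 → l ∈ S ∧ y ∈ T) (F : ℤ × ℤ × (ℤ × ℤ) → ℝ)
    (a b : ℤ) (x : ℤ × ℤ) :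
    fconv G F (a, b, x) = ∑ l ∈ S, ∑ y ∈ T, G (a, l, y) * F (l, b, x - y) := by
  have inner (l : ℤ) : ∑ᶠ y : ℤ × ℤ, G (a, l, y) * F (l, b, x - y) =
      ∑ y ∈ T, G (a, l, y) * F (l, b, x - y) :=
    finsum_eq_sum_of_support_subset _ fun y hy => (hG a l y (left_ne_zero_of_mul hy)).2
  simp only [fconv, inner]
  refine finsum_eq_sum_of_support_subset _ fun l hl => ?_
  obtain ⟨y, -, hy⟩ := Finset.exists_ne_zero_of_sum_ne_zero hl
  exact (hG a l y (left_ne_zero_of_mul hy)).1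

theorem fconv_ne_zero_imp {G F : ℤ × ℤ × (ℤ × ℤ) → ℝ} {S S' : Finset ℤ}
    {T T' : Finset (ℤ × ℤ)} (hG : ∀ a l y, G (a, l, y) ≠ 0 → l ∈ S ∧ y ∈ T)
    (hF : ∀ a l y, F (a, l, y) ≠ 0 → l ∈ S' ∧ y ∈ T') (a m : ℤ) (w : ℤ × ℤ)
    (h : fconv G F (a, m, w) ≠ 0) : m ∈ S' ∧ w ∈ T + T' := by
  rw [fconv_eq_sum hG] at h
  obtain ⟨l, -, hl⟩ := Finset.exists_ne_zero_of_sum_ne_zero h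
  obtain ⟨y, hyT, hy⟩ := Finset.exists_ne_zero_of_sum_ne_zero hl
  obtain ⟨hm, hwy⟩ := hF l m (w - y) (right_ne_zero_of_mul hy)
  exact ⟨hm, Finset.mem_add.2 ⟨y, hyT, w - y, hwy, add_sub_cancel y w⟩⟩

/-- Summing a translate over a sumset recovers the sum over the original set. -/
theorem sum_add_comp_sub {A M : Type*} [AddCommGroup A] [DecidableEq A] [AddCommMonoid M]
    {T T' : Finset A} {f : A → M} (hf : ∀ z, f z ≠ 0 → z ∈ T') {y : A} (hy : y ∈ T) :
    ∑ w ∈ T + T', f (w - y) = ∑ z ∈ T', f z := by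
  symm
  refine Finset.sum_of_injOn (fun z => y + z) (add_right_injective y).injOn
    (fun z hz => Finset.add_mem_add hy hz) (fun w _ hw => ?_) fun z _ => by simp
  by_contra h
  exact hw ⟨w - y, hf _ h, add_sub_cancel y w⟩

/-- The multi-channel convolution `⊛` is associative on finitely supported filters. -/
theorem fconv_assoc (F1 F2 F3 : ℤ × ℤ × (ℤ × ℤ) → ℝ)
    (h1 : (Function.support F1).Finite) (h2 : (Function.support F2).Finite)
    (h3 : (Function.support F3).Finite) :
    fconv F3 (fconv F2 F1) = fconv (fconv F3 F2) F1 := by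
  obtain ⟨S2, T2, H2⟩ := exists_finset_of_finite_support h2
  obtain ⟨S3, T3, H3⟩ := exists_finset_of_finite_support h3
  ext ⟨a, b, x⟩
  rw [fconv_eq_sum H3, fconv_eq_sum (fconv_ne_zero_imp H3 H2)]
  simp only [fconv_eq_sum H2, fconv_eq_sum H3, Finset.mul_sum, Finset.sum_mul]
  calc
    _ = ∑ l ∈ S3, ∑ y ∈ T3, ∑ m ∈ S2, ∑ w ∈ T3 + T2,
        F3 (a, l, y) * F2 (l, m, w - y) * F1 (m, b, x - w) := by
      refine Finset.sum_congr rfl fun l _ => Finset.sum_congr rfl fun y hy =>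
        Finset.sum_congr rfl fun m _ => ?_
      rw [← sum_add_comp_sub (fun z hz => (H2 l m z
        (left_ne_zero_of_mul (right_ne_zero_of_mul hz))).2) hy]
      simp only [sub_sub, add_sub_cancel, mul_assoc]
    _ = ∑ m ∈ S2, ∑ w ∈ T3 + T2, ∑ l ∈ S3, ∑ y ∈ T3,
        F3 (a, l, y) * F2 (l, m, w - y) * F1 (m, b, x - w) := by
      simp_rw [Finset.sum_comm (s := T3) (t := S2), Finset.sum_comm (s := T3) (t := T3 + T2),
        Finset.sum_comm (s := S3) (t := S2), Finset.sum_comm (s := S3) (t := T3 + T2)]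
end

section
/- Morphing correctness for the irreducible module (D): let F₁, …, F₇ and G be finitely supported filters satisfying the modular network morphism equation G = F₅ ⊛ F₁ + F₆ ⊛ F₃ ⊛ F₁ + F₆ ⊛ F₄ ⊛ F₂ + F₇ ⊛ F₂. Then for every finitely supported blob B, the output of module (D), namely F₅ ⊛ B₁ + F₆ ⊛ (F₃ ⊛ B₁ + F₄ ⊛ B₂) + F₇ ⊛ B₂ where B₁ = F₁ ⊛ B and B₂ = F₂ ⊛ B, equals G ⊛ B; i.e., module (D) computes the same blob-to-blob function as the single convolutional layer G. -/
/-- Action of a filter on a blob: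
`(F ⊛ B)(c_j, x) = Σ_{c_i} Σ_y F(c_j, c_i, y) · B(c_i, x − y)`. -/
noncomputable def bconv (F : ℤ × ℤ × (ℤ × ℤ) → ℝ) (B : ℤ × (ℤ × ℤ) → ℝ) :
    ℤ × (ℤ × ℤ) → ℝ :=
  fun p => ∑ᶠ (ci : ℤ) (y : ℤ × ℤ), F (p.1, ci, y) * B (ci, p.2 - y)
/-- `C` contains all input channels and `Y` all positions at which the filter `F` is nonzero. -/
def SupportedIn (F : ℤ × ℤ × (ℤ × ℤ) → ℝ) (C : Finset ℤ) (Y : Finset (ℤ × ℤ)) : Prop :=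
  ∀ c ci y, F (c, ci, y) ≠ 0 → ci ∈ C ∧ y ∈ Y

theorem exists_supportedIn {F : ℤ × ℤ × (ℤ × ℤ) → ℝ} (hF : (Function.support F).Finite) :
    ∃ C Y, SupportedIn F C Y := by
  refine ⟨hF.toFinset.image fun p => p.2.1, hF.toFinset.image fun p => p.2.2, ?_⟩
  intro c ci y h
  have hmem : (c, ci, y) ∈ hF.toFinset := by simpa using h
  exact ⟨Finset.mem_image_of_mem (fun p => p.2.1) hmem,
    Finset.mem_image_of_mem (fun p => p.2.2) hmem⟩

theorem SupportedIn.finsum_eq_sum {F : ℤ × ℤ × (ℤ × ℤ) → ℝ} {C : Finset ℤ}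
    {Y : Finset (ℤ × ℤ)} (hF : SupportedIn F C Y) (c : ℤ) (g : ℤ → ℤ × ℤ → ℝ) :
    ∑ᶠ (ci : ℤ) (y : ℤ × ℤ), F (c, ci, y) * g ci y =
      ∑ ci ∈ C, ∑ y ∈ Y, F (c, ci, y) * g ci y := by
  have inner (ci : ℤ) :
      ∑ᶠ y : ℤ × ℤ, F (c, ci, y) * g ci y = ∑ y ∈ Y, F (c, ci, y) * g ci y :=
    finsum_eq_sum_of_support_subset _ fun y hy =>
      (hF c ci y (left_ne_zero_of_mul hy)).2
  simp only [inner]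
  refine finsum_eq_sum_of_support_subset _ fun ci hci => ?_
  obtain ⟨y, -, hy⟩ := Finset.exists_ne_zero_of_sum_ne_zero hci
  exact (hF c ci y (left_ne_zero_of_mul hy)).1

theorem SupportedIn.fconv_apply {F2 : ℤ × ℤ × (ℤ × ℤ) → ℝ} {C : Finset ℤ}
    {Y : Finset (ℤ × ℤ)} (hF : SupportedIn F2 C Y) (F1 : ℤ × ℤ × (ℤ × ℤ) → ℝ)
    (c ci : ℤ) (x : ℤ × ℤ) :
    fconv F2 F1 (c, ci, x) = ∑ cl ∈ C, ∑ y ∈ Y, F2 (c, cl, y) * F1 (cl, ci, x - y) :=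
  hF.finsum_eq_sum c fun cl y => F1 (cl, ci, x - y)

theorem SupportedIn.bconv_apply {F : ℤ × ℤ × (ℤ × ℤ) → ℝ} {C : Finset ℤ}
    {Y : Finset (ℤ × ℤ)} (hF : SupportedIn F C Y) (B : ℤ × (ℤ × ℤ) → ℝ)
    (c : ℤ) (x : ℤ × ℤ) :
    bconv F B (c, x) = ∑ ci ∈ C, ∑ y ∈ Y, F (c, ci, y) * B (ci, x - y) :=
  hF.finsum_eq_sum c fun ci y => B (ci, x - y)

theorem SupportedIn.mono {F : ℤ × ℤ × (ℤ × ℤ) → ℝ} {C C' : Finset ℤ}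
    {Y Y' : Finset (ℤ × ℤ)} (hF : SupportedIn F C Y) (hC : C ⊆ C') (hY : Y ⊆ Y') :
    SupportedIn F C' Y' :=
  fun c ci y h => ⟨hC (hF c ci y h).1, hY (hF c ci y h).2⟩

theorem SupportedIn.add {F F' : ℤ × ℤ × (ℤ × ℤ) → ℝ} {C D : Finset ℤ}
    {Y Z : Finset (ℤ × ℤ)} (hF : SupportedIn F C Y) (hF' : SupportedIn F' D Z) :
    SupportedIn (F + F') (C ∪ D) (Y ∪ Z) := by
  intro c ci y h
  by_cases h0 : F (c, ci, y) = 0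
  · have := hF' c ci y (by simpa [h0] using h)
    simp [this]
  · have := hF c ci y h0
    simp [this]

open scoped Pointwise in
theorem SupportedIn.fconv {F2 F1 : ℤ × ℤ × (ℤ × ℤ) → ℝ} {C D : Finset ℤ}
    {Y Z : Finset (ℤ × ℤ)} (h2 : SupportedIn F2 C Y) (h1 : SupportedIn F1 D Z) :
    SupportedIn (fconv F2 F1) D (Y + Z) := by
  intro c ci x h
  rw [h2.fconv_apply] at h
  obtain ⟨cl, -, h⟩ := Finset.exists_ne_zero_of_sum_ne_zero h
  obtain ⟨y, hy, h⟩ := Finset.exists_ne_zero_of_sum_ne_zero h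
  obtain ⟨hci, hz⟩ := h1 cl ci (x - y) (right_ne_zero_of_mul h)
  exact ⟨hci, Finset.mem_add.2 ⟨y, hy, x - y, hz, add_sub_cancel y x⟩⟩

open scoped Pointwise in
theorem sum_add_translate {Y Z : Finset (ℤ × ℤ)} {f : ℤ × ℤ → ℝ}
    (hf : ∀ z, f z ≠ 0 → z ∈ Z) {y : ℤ × ℤ} (hy : y ∈ Y) :
    ∑ w ∈ Y + Z, f (w - y) = ∑ z ∈ Z, f z := by
  symm
  refine Finset.sum_of_injOn (y + ·) (add_right_injective y).injOn
    (fun z hz => Finset.add_mem_add hy hz) (fun w _ hw => ?_) (fun z _ => by simp)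
  by_contra h
  exact hw ⟨w - y, hf _ h, add_sub_cancel y w⟩

open scoped Pointwise in
theorem SupportedIn.bconv_bconv {F2 F1 : ℤ × ℤ × (ℤ × ℤ) → ℝ} {C D : Finset ℤ}
    {Y Z : Finset (ℤ × ℤ)} (h2 : SupportedIn F2 C Y) (h1 : SupportedIn F1 D Z)
    (B : ℤ × (ℤ × ℤ) → ℝ) :
    bconv F2 (bconv F1 B) = bconv (_root_.fconv F2 F1) B := by
  ext ⟨c, x⟩
  rw [(h2.fconv h1).bconv_apply, h2.bconv_apply]
  simp only [h1.bconv_apply, h2.fconv_apply, Finset.mul_sum, Finset.sum_mul]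
  have translate (cl ci : ℤ) (y : ℤ × ℤ) (hy : y ∈ Y) :
      ∑ w ∈ Y + Z, F2 (c, cl, y) * F1 (cl, ci, w - y) * B (ci, x - w) =
        ∑ z ∈ Z, F2 (c, cl, y) * (F1 (cl, ci, z) * B (ci, x - y - z)) := by
    rw [← sum_add_translate (fun z hz =>
      (h1 cl ci z (left_ne_zero_of_mul (right_ne_zero_of_mul hz))).2) hy]
    refine Finset.sum_congr rfl fun w _ => ?_
    rw [sub_sub_sub_cancel_right, mul_assoc]
  calc
    _ = ∑ cl ∈ C, ∑ y ∈ Y, ∑ ci ∈ D, ∑ w ∈ Y + Z,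
        F2 (c, cl, y) * F1 (cl, ci, w - y) * B (ci, x - w) :=
      Finset.sum_congr rfl fun cl _ => Finset.sum_congr rfl fun y hy =>
        Finset.sum_congr rfl fun ci _ => (translate cl ci y hy).symm
    _ = ∑ cl ∈ C, ∑ ci ∈ D, ∑ w ∈ Y + Z, ∑ y ∈ Y,
        F2 (c, cl, y) * F1 (cl, ci, w - y) * B (ci, x - w) := by
      refine Finset.sum_congr rfl fun cl _ => ?_
      rw [Finset.sum_comm]
      exact Finset.sum_congr rfl fun ci _ => Finset.sum_comm
    _ = _ := by
      rw [Finset.sum_comm]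
      exact Finset.sum_congr rfl fun ci _ => Finset.sum_comm

theorem SupportedIn.bconv_add {F : ℤ × ℤ × (ℤ × ℤ) → ℝ} {C : Finset ℤ}
    {Y : Finset (ℤ × ℤ)} (hF : SupportedIn F C Y) (B B' : ℤ × (ℤ × ℤ) → ℝ) :
    bconv F (B + B') = bconv F B + bconv F B' := by
  ext ⟨c, x⟩
  simp only [Pi.add_apply, hF.bconv_apply, mul_add, Finset.sum_add_distrib]

theorem SupportedIn.add_bconv {F F' : ℤ × ℤ × (ℤ × ℤ) → ℝ} {C D : Finset ℤ}
    {Y Z : Finset (ℤ × ℤ)} (hF : SupportedIn F C Y) (hF' : SupportedIn F' D Z)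
    (B : ℤ × (ℤ × ℤ) → ℝ) : bconv (F + F') B = bconv F B + bconv F' B := by
  have h := hF.mono (C' := C ∪ D) (Y' := Y ∪ Z)
    Finset.subset_union_left Finset.subset_union_left
  have h' := hF'.mono (C' := C ∪ D) (Y' := Y ∪ Z)
    Finset.subset_union_right Finset.subset_union_right
  ext ⟨c, x⟩
  simp only [Pi.add_apply, h.bconv_apply, h'.bconv_apply, (hF.add hF').bconv_apply, add_mul,
    Finset.sum_add_distrib]

/-- Morphing correctness for the irreducible module (D): if the finitely supported
filters `F₁, …, F₇, G` satisfy the modular network morphism equation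
`G = F₅ ⊛ F₁ + F₆ ⊛ F₃ ⊛ F₁ + F₆ ⊛ F₄ ⊛ F₂ + F₇ ⊛ F₂`, then for every finitely
supported blob `B`, with `B₁ = F₁ ⊛ B` and `B₂ = F₂ ⊛ B`, the output of module (D),
`F₅ ⊛ B₁ + F₆ ⊛ (F₃ ⊛ B₁ + F₄ ⊛ B₂) + F₇ ⊛ B₂`, equals `G ⊛ B`. -/
theorem moduleD_morphing_correct
    (F1 F2 F3 F4 F5 F6 F7 G : ℤ × ℤ × (ℤ × ℤ) → ℝ)
    (h1 : (Function.support F1).Finite) (h2 : (Function.support F2).Finite)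
    (h3 : (Function.support F3).Finite) (h4 : (Function.support F4).Finite)
    (h5 : (Function.support F5).Finite) (h6 : (Function.support F6).Finite)
    (h7 : (Function.support F7).Finite) (hG : (Function.support G).Finite)
    (heq : G = fconv F5 F1 + fconv F6 (fconv F3 F1) + fconv F6 (fconv F4 F2) +
      fconv F7 F2) :
    ∀ B : ℤ × (ℤ × ℤ) → ℝ, (Function.support B).Finite →
      bconv F5 (bconv F1 B) +
        bconv F6 (bconv F3 (bconv F1 B) + bconv F4 (bconv F2 B)) +
          bconv F7 (bconv F2 B) = bconv G B := by
  obtain ⟨C1, Y1, s1⟩ := exists_supportedIn h1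
  obtain ⟨C2, Y2, s2⟩ := exists_supportedIn h2
  obtain ⟨C3, Y3, s3⟩ := exists_supportedIn h3
  obtain ⟨C4, Y4, s4⟩ := exists_supportedIn h4
  obtain ⟨C5, Y5, s5⟩ := exists_supportedIn h5
  obtain ⟨C6, Y6, s6⟩ := exists_supportedIn h6
  obtain ⟨C7, Y7, s7⟩ := exists_supportedIn h7
  intro B _
  have s51 := s5.fconv s1
  have s31 := s3.fconv s1
  have s42 := s4.fconv s2
  have s631 := s6.fconv s31
  have s642 := s6.fconv s42
  have s72 := s7.fconv s2
  rw [heq, ((s51.add s631).add s642).add_bconv s72, (s51.add s631).add_bconv s642,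
    s51.add_bconv s631, s6.bconv_add, s5.bconv_bconv s1, s3.bconv_bconv s1,
    s4.bconv_bconv s2, s6.bconv_bconv s31, s6.bconv_bconv s42, s7.bconv_bconv s2, ← add_assoc
      (bconv (fconv F5 F1) B)]
end
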